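/- arXiv:2101.10950 — 2 statements merged into one kernel-verified Lean document; each statement's English description precedes it below -/
import Mathlib

section
/- Fix a real ψ > 0, a number of classes k ≥ 1, a finite set N of test items with labels s : N → {1, …, k}, and for each class c: a natural number m_c (training size), a function ρ_c : ℕ → ℕ (sufficient statistic of the training data of class c), and for each test item i a function ρ̃_c^{(i)} : ℕ → ℕ (updated sufficient statistic when item i is added to class c). Assume that for every test item i and class c with s(i) ≠ c, ρ̃_{ct}^{(i)} = ρ_{ct} for all t. Define for each class c and item i and each e ∈ {0,1} the factor F(c,i,e) = [ ((m_c + e)!/∏_{j=0}^{m_c+e-1}(ψ+j)) · ∏_{t=1}^{m_c+e} (ψ/t)^{ρ̃_{ct}^{(i)}} / ρ̃_{ct}^{(i)}! ] / [ (m_c!/∏_{j=0}^{m_c-1}(ψ+j)) · ∏_{t=1}^{m_c} (ψ/t)^{ρ_{ct}} / ρ_{ct}! ], assuming all denominators are nonzero. Then the simultaneous-marginal classifier value ∏_{c=1}^{k} ∏_{i : s(i)=c} F(c,i,1) equals the sequential-marginal classifier value ∏_{i ∈ N} ∏_{c=1}^{k} F(c,i,I_c^{(i)}), where I_c^{(i)}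 = 1 if s(i) = c and 0 otherwise. -/
open Finset

theorem stmt_13 (ψ : ℝ) (hψ : 0 < ψ) (k : ℕ) (hk : 1 ≤ k)
    {N : Type*} [Fintype N] [DecidableEq N]
    (s : N → Fin k)
    (m : Fin k → ℕ)
    (ρ : Fin k → ℕ → ℕ)
    (ρ' : Fin k → N → ℕ → ℕ)
    (hout : ∀ (i : N) (c : Fin k), s i ≠ c → ∀ t, ρ' c i t = ρ c t)
    (F : Fin k → N → ℕ → ℝ)
    (hF : ∀ c i e, F c i e =
      ((((m c + e).factorial : ℝ) / ∏ j ∈ Finset.range (m c + e), (ψ + j)) *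
          ∏ t ∈ Finset.Icc 1 (m c + e), (ψ / t) ^ (ρ' c i t) / ((ρ' c i t).factorial : ℝ)) /
        ((((m c).factorial : ℝ) / ∏ j ∈ Finset.range (m c), (ψ + j)) *
          ∏ t ∈ Finset.Icc 1 (m c), (ψ / t) ^ (ρ c t) / ((ρ c t).factorial : ℝ))) :
    ∏ c : Fin k, ∏ i ∈ Finset.univ.filter (fun i => s i = c), F c i 1 =
      ∏ i : N, ∏ c : Fin k, F c i (if s i = c then 1 else 0) := by
  have hone : ∀ i c, s i ≠ c → F c i 0 = 1 := by
    intro i c hic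
    rw [hF]
    simp only [hout i c hic, add_zero]
    apply div_self
    refine ne_of_gt (mul_pos (div_pos (by positivity) ?_) (Finset.prod_pos fun t ht => ?_))
    · exact Finset.prod_pos fun j _ => by positivity
    · have : (0 : ℝ) < t := by exact_mod_cast (Finset.mem_Icc.mp ht).1
      positivity
  rw [Finset.prod_comm (s := (Finset.univ : Finset N))]
  refine Finset.prod_congr rfl fun c _ => ?_
  rw [Finset.prod_filter]
  refine Finset.prod_congr rfl fun i _ => ?_
  split_ifs with h
  · rfl
  · exact (hone i c h).symm
end

section
/- Fix a real ψ > 0 and a number of classes k ≥ 1 with fixed test-class sizes n_1, …, n_k ≥ 1. For each class c let m_c : ℕ → ℕ be a sequence of training sizes with m_c(m) → ∞ as m → ∞, and let S_{l_c} : ℕ → ℝ be any sequences (the sufficient parts) with S_{l_c}(m) → 1 as m → ∞. Define for each c the coefficient part C_{l_c}(m) = [ ((m_c(m)+n_c)! / ∏_{j=0}^{m_c(m)+n_c-1}(ψ+j)) / (m_c(m)! / ∏_{j=0}^{m_c(m)-1}(ψ+j)) ] / [ ((m_c(m)+1)! / ∏_{j=0}^{m_c(m)}(ψ+j)) / (m_c(m)!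 / ∏_{j=0}^{m_c(m)-1}(ψ+j)) ]^{n_c}. Then the full ratio ∏_{c=1}^{k} C_{l_c}(m) · S_{l_c}(m) converges to 1 as m → ∞. -/
open Filter Finset

/-- The normalizing constant `N! / (ψ (ψ + 1) ⋯ (ψ + N - 1))` of the Ewens sampling formula. -/
noncomputable def ewensConst (ψ : ℝ) (N : ℕ) : ℝ :=
  (N.factorial : ℝ) / ∏ j ∈ Finset.range N, (ψ + j)

theorem ewensConst_pos {ψ : ℝ} (hψ : 0 < ψ) (N : ℕ) : 0 < ewensConst ψ N :=
  div_pos (by positivity) (Finset.prod_pos fun j _ => by positivity)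

theorem ewensConst_succ (ψ : ℝ) (N : ℕ) :
    ewensConst ψ (N + 1) = ewensConst ψ N * ((N + 1) / (ψ + N)) := by
  rw [ewensConst, ewensConst, Finset.prod_range_succ, Nat.factorial_succ, div_mul_div_comm]
  push_cast
  ring

theorem tendsto_ewensConst_succ_div {ψ : ℝ} (hψ : 0 < ψ) :
    Tendsto (fun N => ewensConst ψ (N + 1) / ewensConst ψ N) atTop (nhds 1) := by
  have key : Tendsto (fun N : ℕ => 1 + (1 - ψ) / (ψ + N)) atTop (nhds (1 + 0)) :=
    ((tendsto_atTop_add_const_left _ ψ tendsto_natCast_atTop_atTop).const_div_atTop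
      (1 - ψ)).const_add 1
  rw [add_zero] at key
  refine key.congr fun N => ?_
  have hN : ψ + N ≠ 0 := by positivity
  rw [ewensConst_succ, mul_div_cancel_left₀ _ (ewensConst_pos hψ N).ne']
  field_simp
  ring

theorem tendsto_ewensConst_add_div {ψ : ℝ} (hψ : 0 < ψ) (n : ℕ) :
    Tendsto (fun N => ewensConst ψ (N + n) / ewensConst ψ N) atTop (nhds 1) := by
  induction n with
  | zero => simp [(ewensConst_pos hψ _).ne']
  | succ n ih =>
    have h := ((tendsto_ewensConst_succ_div hψ).comp (tendsto_add_atTop_nat n)).mul ih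
    rw [one_mul] at h
    exact h.congr fun N => div_mul_div_cancel₀ (ewensConst_pos hψ (N + n)).ne'

theorem stmt_14 (ψ : ℝ) (hψ : 0 < ψ) (k : ℕ) (hk : 1 ≤ k)
    (n : Fin k → ℕ) (hn : ∀ c, 1 ≤ n c)
    (m : Fin k → ℕ → ℕ) (hm : ∀ c, Tendsto (m c) atTop atTop)
    (Sl : Fin k → ℕ → ℝ) (hSl : ∀ c, Tendsto (Sl c) atTop (nhds 1))
    (C : Fin k → ℕ → ℝ)
    (hC : ∀ c M, C c M =
      ((((m c M + n c).factorial : ℝ) / ∏ j ∈ Finset.range (m c M + n c), (ψ + j)) /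
          (((m c M).factorial : ℝ) / ∏ j ∈ Finset.range (m c M), (ψ + j))) /
        ((((m c M + 1).factorial : ℝ) / ∏ j ∈ Finset.range (m c M + 1), (ψ + j)) /
          (((m c M).factorial : ℝ) / ∏ j ∈ Finset.range (m c M), (ψ + j))) ^ (n c)) :
    Tendsto (fun M : ℕ => ∏ c : Fin k, C c M * Sl c M) atTop (nhds 1) := by
  have hcoef (c : Fin k) : Tendsto (C c) atTop (nhds 1) := by
    have h := ((tendsto_ewensConst_add_div hψ (n c)).div
      ((tendsto_ewensConst_succ_div hψ).pow (n c)) (by simp)).comp (hm c)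
    rw [one_pow, div_one] at h
    exact h.congr fun M => (hC c M).symm
  simpa using tendsto_finsetProd Finset.univ fun c _ => (hcoef c).mul (hSl c)
end
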